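/- Let (t_k)_{k≥0} satisfy condition (T) with t_k² ε_k → +∞, let 0 < s < 1/L, and let (x_k), (y_k) be generated by (TIREPROG). Let k₀ ∈ ℕ be such that s ≤ 1/(L + ε_{k₀}). Assume that liminf_{k→∞} (−t_k² + t_k + t_{k−1}²)/t_k > 0, that the sequence (t_k² ε_k)_{k≥k₀−1} is increasing, that lim_{k→∞} t_k² ε_k = +∞, and that lim_{k→∞} t_k(ε_k − ε_{k+1})/ε_k = 0. Then the sequence (x_k) converges strongly to x*, the minimum norm element of argmin(f+g), and moreover ‖x_k − y_k‖/√ε_k → 0 as k → +∞ (so (y_k) also converges strongly to x*). -/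

import Mathlib

open Filter Topology
open scoped RealInnerProductSpace

section Auxiliary

variable {H : Type*} [NormedAddCommGroup H] [InnerProductSpace ℝ H]

lemma norm_sq_convex_combination (a b : H) (r : ℝ) :
    ‖(1 - r) • a + r • b‖ ^ 2 = (1 - r) * ‖a‖ ^ 2 + r * ‖b‖ ^ 2 - r * (1 - r) * ‖b - a‖ ^ 2 := by
  simp only [← real_inner_self_eq_norm_sq, inner_add_left, inner_add_right, inner_sub_left,
    inner_sub_right, real_inner_smul_left, real_inner_smul_right, real_inner_comm b a]
  ring

/-- Three-point inequality for a minimizer of `u ↦ φ u + ‖u - w‖² / (2 s)`, with `φ` convex. -/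
lemma prox_three_point {D : Set H} {φ : H → ℝ} (hφ : ConvexOn ℝ D φ) {s : ℝ} {p w : H}
    (hp : p ∈ D)
    (hmin : ∀ u ∈ D, φ p + ‖p - w‖ ^ 2 / (2 * s) ≤ φ u + ‖u - w‖ ^ 2 / (2 * s))
    {u : H} (hu : u ∈ D) :
    φ p + ‖p - w‖ ^ 2 / (2 * s) + ‖u - p‖ ^ 2 / (2 * s) ≤ φ u + ‖u - w‖ ^ 2 / (2 * s) := by
  have key : ∀ r ∈ Set.Ioo (0 : ℝ) 1,
      φ p + ‖p - w‖ ^ 2 / (2 * s) + (1 - r) * (‖u - p‖ ^ 2 / (2 * s))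
        ≤ φ u + ‖u - w‖ ^ 2 / (2 * s) := by
    rintro r ⟨hr0, hr1⟩
    have h1 := hmin _ (hφ.1 hp hu (sub_nonneg.2 hr1.le) hr0.le (sub_add_cancel 1 r))
    have h2 := hφ.2 hp hu (sub_nonneg.2 hr1.le) hr0.le (sub_add_cancel 1 r)
    have h3 := norm_sq_convex_combination (p - w) (u - w) r
    have h4 : (1 - r) • (p - w) + r • (u - w) = ((1 - r) • p + r • u) - w := by module
    rw [h4, sub_sub_sub_cancel_right] at h3
    rw [h3] at h1
    simp only [smul_eq_mul] at h2
    refine le_of_mul_le_mul_left ?_ hr0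
    have h5 : ((1 - r) * ‖p - w‖ ^ 2 + r * ‖u - w‖ ^ 2 - r * (1 - r) * ‖u - p‖ ^ 2) / (2 * s)
        = (1 - r) * (‖p - w‖ ^ 2 / (2 * s)) + r * (‖u - w‖ ^ 2 / (2 * s))
          - r * (1 - r) * (‖u - p‖ ^ 2 / (2 * s)) := by ring
    rw [h5] at h1
    linarith
  have hlim : Tendsto (fun r : ℝ => φ p + ‖p - w‖ ^ 2 / (2 * s)
      + (1 - r) * (‖u - p‖ ^ 2 / (2 * s))) (𝓝[>] 0)
      (𝓝 (φ p + ‖p - w‖ ^ 2 / (2 * s) + (1 - 0) * (‖u - p‖ ^ 2 / (2 * s)))) := by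
    refine Tendsto.mono_left (Continuous.tendsto ?_ 0) nhdsWithin_le_nhds
    fun_prop
  rw [sub_zero, one_mul] at hlim
  refine le_of_tendsto hlim ?_
  filter_upwards [Ioo_mem_nhdsGT (zero_lt_one' ℝ)] with r hr using key r hr

section Gradient

variable [CompleteSpace H] {g : H → ℝ} {g' : H → H}

lemma hasDerivAt_along_line (hg : ∀ u, HasGradientAt g (g' u) u) (a d : H) (r : ℝ) :
    HasDerivAt (fun r : ℝ => g (a + r • d)) ⟪g' (a + r • d), d⟫ r := by
  have h1 : HasDerivAt (fun r : ℝ => a + r • d) d r := by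
    simpa using ((hasDerivAt_id r).smul_const d).const_add a
  have h2 := (hg (a + r • d)).hasFDerivAt.comp_hasDerivAt r h1
  rw [InnerProductSpace.toDual_apply_apply] at h2
  exact h2

lemma convex_gradient_inequality (hc : ConvexOn ℝ Set.univ g)
    (hg : ∀ u, HasGradientAt g (g' u) u) (a u : H) :
    g a + ⟪g' a, u - a⟫ ≤ g u := by
  have hline : ConvexOn ℝ Set.univ (fun r : ℝ => g (a + r • (u - a))) := by
    refine ⟨convex_univ, fun p _ q _ α β hα hβ hαβ => ?_⟩
    have := hc.2 (Set.mem_univ (a + p • (u - a))) (Set.mem_univ (a + q • (u - a))) hα hβ hαβ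
    convert this using 2
    obtain rfl : α = 1 - β := by linarith
    simp only [smul_eq_mul]
    module
  have h := hline.le_slope_of_hasDerivAt (Set.mem_univ 0) (Set.mem_univ 1) one_pos
    (hasDerivAt_along_line hg a (u - a) 0)
  simp only [slope_def_field, zero_smul, add_zero, one_smul, add_sub_cancel, sub_zero,
    div_one] at h
  linarith

lemma descent_inequality {L : ℝ} (hg : ∀ u, HasGradientAt g (g' u) u)
    (hlip : ∀ u v, ‖g' u - g' v‖ ≤ L * ‖u - v‖) (a u : H) :
    g u ≤ g a + ⟪g' a, u - a⟫ + L / 2 * ‖u - a‖ ^ 2 := by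
  set d := u - a with hd
  have hder : ∀ r : ℝ, HasDerivAt
      (fun r : ℝ => g (a + r • d) - (r * ⟪g' a, d⟫ + L / 2 * ‖d‖ ^ 2 * r ^ 2))
      (⟪g' (a + r • d), d⟫ - (1 * ⟪g' a, d⟫ + L / 2 * ‖d‖ ^ 2 * (2 * r))) r := fun r => by
    refine (hasDerivAt_along_line hg a d r).sub (((hasDerivAt_id r).mul_const _).add ?_)
    simpa using (hasDerivAt_pow 2 r).const_mul (L / 2 * ‖d‖ ^ 2)
  have hanti : AntitoneOn
      (fun r : ℝ => g (a + r • d) - (r * ⟪g' a, d⟫ + L / 2 * ‖d‖ ^ 2 * r ^ 2))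
      (Set.Icc 0 1) := by
    refine antitoneOn_of_deriv_nonpos (convex_Icc 0 1)
      (fun r _ => (hder r).continuousAt.continuousWithinAt)
      (fun r _ => (hder r).differentiableAt.differentiableWithinAt) fun r hr => ?_
    rw [interior_Icc] at hr
    rw [(hder r).deriv]
    have h1 : ⟪g' (a + r • d) - g' a, d⟫ ≤ L * (r * ‖d‖) * ‖d‖ := by
      refine (real_inner_le_norm _ _).trans (mul_le_mul_of_nonneg_right ?_ (norm_nonneg d))
      have := hlip (a + r • d) a
      rwa [add_sub_cancel_left, norm_smul, Real.norm_of_nonneg hr.1.le] at this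
    rw [inner_sub_left] at h1
    linarith
  have h := hanti (Set.left_mem_Icc.2 zero_le_one) (Set.right_mem_Icc.2 zero_le_one) zero_le_one
  simp only [one_smul, zero_smul, add_zero, hd, add_sub_cancel] at h
  rw [← hd] at h
  linarith

/-- One forward-backward step for the Tikhonov-regularized objective. -/
lemma forward_backward_inequality {D : Set H} {φ : H → ℝ} (hφ : ConvexOn ℝ D φ) {L s e : ℝ}
    (hc : ConvexOn ℝ Set.univ g) (hg : ∀ u, HasGradientAt g (g' u) u)
    (hlip : ∀ u v, ‖g' u - g' v‖ ≤ L * ‖u - v‖) (hs : 0 < s) (he : 0 ≤ e)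
    (hse : s * (L + e) ≤ 1) {p y : H} (hp : p ∈ D)
    (hmin : ∀ u ∈ D, φ p + ‖p - (y - s • g' y - (s * e) • y)‖ ^ 2 / (2 * s)
      ≤ φ u + ‖u - (y - s • g' y - (s * e) • y)‖ ^ 2 / (2 * s)) {u : H} (hu : u ∈ D) :
    φ p + g p + e / 2 * ‖p‖ ^ 2 + ‖u - p‖ ^ 2 / (2 * s)
      ≤ φ u + g u + e / 2 * ‖u‖ ^ 2 + ‖u - y‖ ^ 2 / (2 * s) := by
  have h1 := prox_three_point hφ hp hmin hu
  have h2 := convex_gradient_inequality hc hg y u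
  have h3 := descent_inequality hg hlip y p
  have expand : ∀ v : H, ‖v - (y - s • g' y - (s * e) • y)‖ ^ 2 / (2 * s)
      = ‖v - y‖ ^ 2 / (2 * s) + ⟪g' y, v - y⟫ + e * ⟪y, v - y⟫
        + s / 2 * ‖g' y + e • y‖ ^ 2 := fun v => by
    have : v - (y - s • g' y - (s * e) • y) = (v - y) + s • (g' y + e • y) := by module
    rw [this, norm_add_sq_real, norm_smul, Real.norm_of_nonneg hs.le, real_inner_smul_right,
      inner_add_right, real_inner_smul_right, real_inner_comm (g' y), real_inner_comm y]
    field_simp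
    ring
  have tik : ∀ v : H, e / 2 * ‖v‖ ^ 2
      = e / 2 * ‖y‖ ^ 2 + e * ⟪y, v - y⟫ + e / 2 * ‖v - y‖ ^ 2 := fun v => by
    have : ‖v‖ ^ 2 = ‖y + (v - y)‖ ^ 2 := by rw [add_sub_cancel]
    rw [this, norm_add_sq_real]
    ring
  rw [expand p, expand u] at h1
  rw [tik p, tik u]
  have h4 : (L + e) / 2 * ‖p - y‖ ^ 2 ≤ ‖p - y‖ ^ 2 / (2 * s) := by
    rw [le_div_iff₀ (by positivity)]
    have := mul_le_mul_of_nonneg_right hse (sq_nonneg ‖p - y‖)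
    linarith
  have h5 : 0 ≤ e / 2 * ‖u - y‖ ^ 2 := by positivity
  linarith

end Gradient

/-- Decrease of the Nesterov-type energy along one step with parameters `τ`, `t`. -/
lemma energy_step {D : Set H} {Φ : H → ℝ} (hΦ : ConvexOn ℝ D Φ) {s e t τ : ℝ}
    (hs : 0 < s) (he : 0 ≤ e) (ht : 1 ≤ t) (hτ : 0 < τ) (hθ : t * (t - 1) ≤ τ ^ 2)
    {x p y z xs : H} (hx : x ∈ D) (hxs : xs ∈ D)
    (hy : t • y = (t - 1) • x + (t * (t - 1) / τ ^ 2) • z)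
    (hfb : ∀ u ∈ D, Φ p + e / 2 * ‖p‖ ^ 2 + ‖u - p‖ ^ 2 / (2 * s)
      ≤ Φ u + e / 2 * ‖u‖ ^ 2 + ‖u - y‖ ^ 2 / (2 * s)) :
    t ^ 2 * (Φ p + e / 2 * ‖p‖ ^ 2 - (Φ xs + e / 2 * ‖xs‖ ^ 2))
        + ‖t • p - (t - 1) • x - xs‖ ^ 2 / (2 * s)
      ≤ t * (t - 1) / τ ^ 2 * (τ ^ 2 * (Φ x + e / 2 * ‖x‖ ^ 2 - (Φ xs + e / 2 * ‖xs‖ ^ 2))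
        + ‖z - xs‖ ^ 2 / (2 * s)) + (1 - t * (t - 1) / τ ^ 2) * (‖xs‖ ^ 2 / (2 * s)) := by
  have ht0 : 0 < t := by linarith
  set θ := t * (t - 1) / τ ^ 2 with hθdef
  have hθ0 : 0 ≤ θ := div_nonneg (mul_nonneg ht0.le (by linarith)) (sq_nonneg τ)
  have hθ1 : θ ≤ 1 := (div_le_one (by positivity)).2 hθ
  have hθτ : θ * τ ^ 2 = t * (t - 1) := by rw [hθdef]; field_simp
  have hr1 : 0 ≤ 1 - 1 / t := sub_nonneg.2 ((div_le_one ht0).2 ht)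
  have hr0 : 0 ≤ 1 / t := by positivity
  set u := (1 - 1 / t) • x + (1 / t) • xs with hudef
  have hu := hfb u (hΦ.1 hx hxs hr1 hr0 (sub_add_cancel 1 _))
  have hΦu := hΦ.2 hx hxs hr1 hr0 (sub_add_cancel 1 _)
  have hnu := norm_sq_convex_combination x xs (1 / t)
  rw [← hudef] at hΦu hnu
  simp only [smul_eq_mul] at hΦu
  have htu : t • u = (t - 1) • x + xs := by
    rw [hudef, smul_add, smul_smul, smul_smul]
    have e1 : t * (1 - 1 / t) = t - 1 := by field_simp
    have e2 : t * (1 / t) = 1 := by field_simp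
    rw [e1, e2, one_smul]
  have hscale : ∀ v : H, t ^ 2 * ‖v‖ ^ 2 = ‖t • v‖ ^ 2 := fun v => by
    rw [norm_smul, Real.norm_of_nonneg ht0.le, mul_pow]
  have hA : t ^ 2 * ‖u - p‖ ^ 2 = ‖t • p - (t - 1) • x - xs‖ ^ 2 := by
    rw [hscale, smul_sub, htu, ← norm_neg]
    congr 2
    abel
  have hB : t ^ 2 * ‖u - y‖ ^ 2 ≤ θ * ‖z - xs‖ ^ 2 + (1 - θ) * ‖xs‖ ^ 2 := by
    have h1 : t • u - t • y = (1 - θ) • xs + θ • (xs - z) := by rw [htu, hy]; module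
    rw [hscale, smul_sub, h1, norm_sq_convex_combination, norm_sub_rev xs z]
    have : 0 ≤ θ * (1 - θ) * ‖xs - z - xs‖ ^ 2 :=
      mul_nonneg (mul_nonneg hθ0 (sub_nonneg.2 hθ1)) (sq_nonneg _)
    linarith
  have hC : Φ u + e / 2 * ‖u‖ ^ 2
      ≤ (1 - 1 / t) * (Φ x + e / 2 * ‖x‖ ^ 2) + 1 / t * (Φ xs + e / 2 * ‖xs‖ ^ 2) := by
    have : 0 ≤ e / 2 * (1 / t * (1 - 1 / t) * ‖xs - x‖ ^ 2) := by positivity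
    rw [hnu]
    linarith
  have hC' := mul_le_mul_of_nonneg_left hC (sq_nonneg t)
  have hC'' : t ^ 2 * ((1 - 1 / t) * (Φ x + e / 2 * ‖x‖ ^ 2) + 1 / t * (Φ xs + e / 2 * ‖xs‖ ^ 2))
      = t * (t - 1) * (Φ x + e / 2 * ‖x‖ ^ 2) + t * (Φ xs + e / 2 * ‖xs‖ ^ 2) := by
    field_simp
  rw [hC''] at hC'
  have hD := mul_le_mul_of_nonneg_left hu (sq_nonneg t)
  have hB' := div_le_div_of_nonneg_right hB (by positivity : 0 ≤ 2 * s)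
  have hE : t ^ 2 * (Φ p + e / 2 * ‖p‖ ^ 2 + ‖u - p‖ ^ 2 / (2 * s))
      = t ^ 2 * (Φ p + e / 2 * ‖p‖ ^ 2) + (t ^ 2 * ‖u - p‖ ^ 2) / (2 * s) := by ring
  have hF : t ^ 2 * (Φ u + e / 2 * ‖u‖ ^ 2 + ‖u - y‖ ^ 2 / (2 * s))
      = t ^ 2 * (Φ u + e / 2 * ‖u‖ ^ 2) + (t ^ 2 * ‖u - y‖ ^ 2) / (2 * s) := by ring
  rw [hE, hF, hA] at hD
  have hG : θ * (τ ^ 2 * (Φ x + e / 2 * ‖x‖ ^ 2 - (Φ xs + e / 2 * ‖xs‖ ^ 2))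
        + ‖z - xs‖ ^ 2 / (2 * s)) + (1 - θ) * (‖xs‖ ^ 2 / (2 * s))
      = t * (t - 1) * (Φ x + e / 2 * ‖x‖ ^ 2 - (Φ xs + e / 2 * ‖xs‖ ^ 2))
        + (θ * ‖z - xs‖ ^ 2 + (1 - θ) * ‖xs‖ ^ 2) / (2 * s) := by
    rw [← hθτ]; ring
  rw [hG]
  linarith

/-- A recursion `E_{k+1} ≤ (1 - a_k) E_k + a_k δ W_k` with `W` nondecreasing and unbounded
forces `E_{k+1} ≤ δ W_k` eventually. -/
lemma eventually_le_of_averaged_recursion {E W a : ℕ → ℝ} {δ : ℝ} (hδ : 0 < δ)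
    (hW : Tendsto W atTop atTop) (hmono : ∀ᶠ k in atTop, W k ≤ W (k + 1))
    (ha : ∀ᶠ k in atTop, 0 ≤ a k ∧ a k ≤ 1)
    (hrec : ∀ᶠ k in atTop, E (k + 1) ≤ (1 - a k) * E k + a k * (δ * W k)) :
    ∀ᶠ k in atTop, E (k + 1) ≤ δ * W k := by
  obtain ⟨K, hK⟩ := eventually_atTop.1 (hmono.and (ha.and hrec))
  have hind : ∀ k, K ≤ k → E (k + 1) ≤ max (E K) (δ * W k) := by
    intro k hk
    induction k, hk using Nat.le_induction with
    | base =>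
      obtain ⟨-, ⟨h0, h1⟩, hr⟩ := hK K le_rfl
      nlinarith [le_max_left (E K) (δ * W K), le_max_right (E K) (δ * W K)]
    | succ k hk ih =>
      obtain ⟨-, ⟨h0, h1⟩, hr⟩ := hK (k + 1) (hk.trans k.le_succ)
      have hm : δ * W k ≤ δ * W (k + 1) := mul_le_mul_of_nonneg_left (hK k hk).1 hδ.le
      have ih' := ih.trans (max_le_max_left (E K) hm)
      nlinarith [le_max_right (E K) (δ * W (k + 1))]
  filter_upwards [eventually_ge_atTop K, (hW.const_mul_atTop hδ).eventually_ge_atTop (E K)]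
    with k hk hk'
  exact (hind k hk).trans (max_le hk' le_rfl)

/-- A minimizing sequence whose norms do not asymptotically exceed that of the minimizer of
least norm converges strongly to it. -/
lemma tendsto_min_norm_minimizer [CompleteSpace H] {D : Set H} {Φ : H → ℝ}
    (hΦ : ConvexOn ℝ D Φ) (hclosed : ∀ c : ℝ, IsClosed {z ∈ D | Φ z ≤ c}) {xs : H}
    (hxs : xs ∈ D) (hnorm : ∀ u ∈ D, Φ u ≤ Φ xs → ‖xs‖ ≤ ‖u‖) {v : ℕ → H}
    (hvD : ∀ᶠ k in atTop, v k ∈ D) (hv : ∀ δ > 0, ∀ᶠ k in atTop, Φ (v k) ≤ Φ xs + δ)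
    (hvn : ∀ δ > 0, ∀ᶠ k in atTop, ‖v k‖ ^ 2 ≤ ‖xs‖ ^ 2 + δ) :
    Tendsto v atTop (𝓝 xs) := by
  set C : ℕ → Set H := fun n => {z ∈ D | Φ z ≤ Φ xs + 1 / ((n : ℝ) + 1)} with hC
  have hpos : ∀ n : ℕ, (0 : ℝ) < 1 / ((n : ℝ) + 1) := fun n => Nat.one_div_pos_of_nat
  have hxsC : ∀ n, xs ∈ C n := fun n => ⟨hxs, by linarith [hpos n]⟩
  have hproj : ∀ n, ∃ q ∈ C n, ∀ w ∈ C n, ‖w - q‖ ^ 2 ≤ ‖w‖ ^ 2 - ‖q‖ ^ 2 := by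
    intro n
    have hconv : Convex ℝ (C n) := hΦ.convex_le _
    obtain ⟨q, hq, hmin⟩ := exists_norm_eq_iInf_of_complete_convex ⟨xs, hxsC n⟩
      (hclosed _).isComplete hconv 0
    refine ⟨q, hq, fun w hw => ?_⟩
    have h1 := (norm_eq_iInf_iff_real_inner_le_zero hconv hq).1 hmin w hw
    have h2 : ‖w‖ ^ 2 = ‖q + (w - q)‖ ^ 2 := by rw [add_sub_cancel]
    rw [zero_sub, inner_neg_left] at h1
    rw [h2, norm_add_sq_real]
    linarith
  choose q hqC hq using hproj
  have hanti : ∀ n m, n ≤ m → C m ⊆ C n := fun n m h w hw =>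
    ⟨hw.1, hw.2.trans (by gcongr)⟩
  have hqmono : Monotone fun n => ‖q n‖ ^ 2 := fun n m h => by
    have := hq n (q m) (hanti n m h (hqC m))
    have h0 := sq_nonneg ‖q m - q n‖
    show ‖q n‖ ^ 2 ≤ ‖q m‖ ^ 2
    linarith
  have hqbdd : ∀ n, ‖q n‖ ^ 2 ≤ ‖xs‖ ^ 2 := fun n => by
    have := hq n xs (hxsC n)
    have h0 := sq_nonneg ‖xs - q n‖
    linarith
  obtain ⟨l, hl⟩ : ∃ l, Tendsto (fun n => ‖q n‖ ^ 2) atTop (𝓝 l) :=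
    ⟨_, tendsto_atTop_ciSup hqmono ⟨‖xs‖ ^ 2, by rintro _ ⟨n, rfl⟩; exact hqbdd n⟩⟩
  have hqcauchy : CauchySeq q := by
    refine cauchySeq_of_le_tendsto_0' (fun n => √(l - ‖q n‖ ^ 2)) (fun n m h => ?_) ?_
    · rw [dist_comm, dist_eq_norm]
      refine Real.le_sqrt_of_sq_le ((hq n (q m) (hanti n m h (hqC m))).trans ?_)
      have := hqmono.ge_of_tendsto hl m
      linarith
    · have := (tendsto_const_nhds (x := l)).sub hl
      simpa using this.sqrt
  obtain ⟨p, hp⟩ := cauchySeq_tendsto_of_complete hqcauchy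
  have hpC : ∀ n, p ∈ C n := fun n => (hclosed _).mem_of_tendsto hp
    (by filter_upwards [eventually_ge_atTop n] with m hm using hanti n m hm (hqC m))
  have hpmin : Φ p ≤ Φ xs := by
    have h1 := (tendsto_one_div_add_atTop_nhds_zero_nat (𝕜 := ℝ)).const_add (Φ xs)
    rw [add_zero] at h1
    exact ge_of_tendsto' h1 fun n => (hpC n).2
  have hlp : l = ‖p‖ ^ 2 := tendsto_nhds_unique hl (hp.norm.pow 2)
  have hle : ‖xs‖ ^ 2 ≤ l := by
    rw [hlp]
    exact pow_le_pow_left₀ (norm_nonneg _) (hnorm p (hpC 0).1 hpmin) 2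
  rw [Metric.tendsto_nhds]
  intro η hη
  have hη' : 0 < η ^ 2 / 16 := by positivity
  obtain ⟨n, hn⟩ := (hl.eventually (lt_mem_nhds
    (show ‖xs‖ ^ 2 - η ^ 2 / 16 < l by linarith))).exists
  filter_upwards [hvD, hv _ (hpos n), hvn _ hη'] with k h1 h2 h3
  have h4 := hq n (v k) ⟨h1, h2⟩
  have h5 := hq n xs (hxsC n)
  have h6 : ‖v k - q n‖ < η / 2 := lt_of_pow_lt_pow_left₀ 2 (by positivity) (by nlinarith)
  have h7 : ‖xs - q n‖ < η / 2 := lt_of_pow_lt_pow_left₀ 2 (by positivity) (by nlinarith)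
  calc dist (v k) xs ≤ dist (v k) (q n) + dist xs (q n) := dist_triangle_right _ _ _
    _ < η := by rw [dist_eq_norm, dist_eq_norm]; linarith

/-- The real part of a proper convex extended-real function is convex on its domain. -/
lemma convexOn_toReal_domain {f : H → EReal} (hbot : ∀ z, f z ≠ ⊥)
    (hconv : ∀ u v : H, ∀ a b : ℝ, 0 ≤ a → 0 ≤ b → a + b = 1 →
      f (a • u + b • v) ≤ (a : EReal) * f u + (b : EReal) * f v) :
    ConvexOn ℝ {z | f z ≠ ⊤} fun z => (f z).toReal := by
  have key : ∀ u v : H, f u ≠ ⊤ → f v ≠ ⊤ → ∀ a b : ℝ, 0 ≤ a → 0 ≤ b → a + b = 1 →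
      f (a • u + b • v) ≤ ((a * (f u).toReal + b * (f v).toReal : ℝ) : EReal) := by
    intro u v hu hv a b ha hb hab
    have h := hconv u v a b ha hb hab
    rw [← EReal.coe_toReal hu (hbot u), ← EReal.coe_toReal hv (hbot v)] at h
    exact_mod_cast h
  refine ⟨fun u hu v hv a b ha hb hab => ?_, fun u hu v hv a b ha hb hab => ?_⟩
  · exact ne_top_of_le_ne_top (EReal.coe_ne_top _) (key u v hu hv a b ha hb hab)
  · have h := EReal.toReal_le_toReal (key u v hu hv a b ha hb hab) (hbot _) (EReal.coe_ne_top _)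
    rwa [EReal.toReal_coe] at h

end Auxiliary

/-- Theorem 2 (strong convergence part): under condition (T), `liminf (−t_k²+t_k+t_{k−1}²)/t_k > 0`,
`(t_k² ε_k)` increasing for `k ≥ k₀ − 1`, `t_k² ε_k → +∞` and `t_k(ε_k − ε_{k+1})/ε_k → 0`,
the sequence `(x_k)` generated by (TIREPROG) converges strongly to the minimum norm minimizer `x*`
of `f + g`, and `‖x_k − y_k‖/√ε_k → 0`, so `(y_k)` also converges strongly to `x*`. -/
theorem tireprog_strong_convergence
    {H : Type*} [NormedAddCommGroup H] [InnerProductSpace ℝ H] [CompleteSpace H]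
    (f : H → EReal) (g : H → ℝ) (g' : H → H) (L : ℝ) (hL : 0 < L)
    -- f is proper, convex and lower semicontinuous
    (hf_proper : ∃ z, f z ≠ ⊤) (hf_nebot : ∀ z, f z ≠ ⊥)
    (hf_convex : ∀ u v : H, ∀ a b : ℝ, 0 ≤ a → 0 ≤ b → a + b = 1 →
      f (a • u + b • v) ≤ (a : EReal) * f u + (b : EReal) * f v)
    (hf_lsc : LowerSemicontinuous f)
    -- g is convex, differentiable with L-Lipschitz gradient g'
    (hg_convex : ConvexOn ℝ Set.univ g)
    (hg_diff : ∀ u : H, HasGradientAt g (g' u) u)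
    (hg_lip : ∀ u v : H, ‖g' u - g' v‖ ≤ L * ‖u - v‖)
    -- prox_{σ f} is a minimizer of u ↦ f(u) + ‖u − z‖²/(2σ)
    (prox : ℝ → H → H)
    (hprox : ∀ σ : ℝ, 0 < σ → ∀ z u : H,
      f (prox σ z) + ((‖prox σ z - z‖ ^ 2 / (2 * σ) : ℝ) : EReal)
        ≤ f u + ((‖u - z‖ ^ 2 / (2 * σ) : ℝ) : EReal))
    -- the sequence (t_k) satisfies condition (T)
    (t : ℕ → ℝ) (ht0 : t 0 = 1)
    (hT : ∀ k : ℕ, 1 ≤ k →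
      t (k - 1) < t k ∧ t k < (1 + Real.sqrt (1 + 4 * t (k - 1) ^ 2)) / 2)
    -- (ε_k) is a nonincreasing sequence of positive reals tending to 0
    (ε : ℕ → ℝ) (hε_pos : ∀ k : ℕ, 1 ≤ k → 0 < ε k)
    (hε_anti : ∀ k : ℕ, 1 ≤ k → ε (k + 1) ≤ ε k)
    (hε_lim : Tendsto ε atTop (nhds (0 : ℝ)))
    -- the stepsize
    (s : ℝ) (hs_pos : 0 < s) (hs_lt : s < 1 / L)
    -- the algorithm (TIREPROG)
    (x y : ℕ → H)
    (hy : ∀ k : ℕ, 1 ≤ k → y k = x k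
        + (((t k - 1) * (t (k - 1) - 1)) / (t (k - 1)) ^ 2) • (x k - x (k - 1))
        - (((-(t k) ^ 2 + t k + (t (k - 1)) ^ 2) / ((t (k - 1)) ^ 2 * t k))) • x k)
    (hx : ∀ k : ℕ, 1 ≤ k →
      x (k + 1) = prox s (y k - s • g' (y k) - (s * ε k) • y k))
    -- x* is the minimum norm element of argmin (f + g)
    (xstar : H)
    (hxstar_min : ∀ u : H, f xstar + (g xstar : EReal) ≤ f u + (g u : EReal))
    (hxstar_norm : ∀ u : H,
      (∀ v : H, f u + (g u : EReal) ≤ f v + (g v : EReal)) → ‖xstar‖ ≤ ‖u‖)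
    -- k₀ with s ≤ 1/(L + ε_{k₀})
    (k₀ : ℕ) (hk₀ : s ≤ 1 / (L + ε k₀))
    -- the hypotheses on the parameters
    (hliminf : 0 < atTop.liminf (fun k : ℕ => (-(t k) ^ 2 + t k + (t (k - 1)) ^ 2) / t k))
    (hincr : ∀ k : ℕ, k₀ - 1 ≤ k → (t k) ^ 2 * ε k < (t (k + 1)) ^ 2 * ε (k + 1))
    (htε_top : Tendsto (fun k : ℕ => (t k) ^ 2 * ε k) atTop atTop)
    (hratio : Tendsto (fun k : ℕ => t k * (ε k - ε (k + 1)) / ε k) atTop (nhds (0 : ℝ))) :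
    Tendsto x atTop (nhds xstar) ∧
    Tendsto (fun k : ℕ => ‖x k - y k‖ / Real.sqrt (ε k)) atTop (nhds (0 : ℝ)) ∧
    Tendsto y atTop (nhds xstar) := by
  set D : Set H := {z | f z ≠ ⊤}
  set φ : H → ℝ := fun z => (f z).toReal
  have hcoe : ∀ z ∈ D, f z = (φ z : EReal) := fun z hz => (EReal.coe_toReal hz (hf_nebot z)).symm
  have hφ : ConvexOn ℝ D φ := convexOn_toReal_domain hf_nebot hf_convex
  set Φ : H → ℝ := fun z => φ z + g z
  have hΦ : ConvexOn ℝ D Φ := hφ.add (hg_convex.subset (Set.subset_univ _) hφ.1)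
  have hmemD : ∀ {u v : H} {a b : ℝ}, v ∈ D → f u + (a : EReal) ≤ f v + (b : EReal) → u ∈ D := by
    intro u v a b hv h hu
    rw [hu, EReal.top_add_coe, hcoe v hv, ← EReal.coe_add, top_le_iff] at h
    exact EReal.coe_ne_top _ h
  obtain ⟨z₀, hz₀⟩ := hf_proper
  have hxsD : xstar ∈ D := hmemD hz₀ (hxstar_min z₀)
  have hΦmin : ∀ u ∈ D, Φ xstar ≤ Φ u := fun u hu => by
    have := hxstar_min u
    rw [hcoe u hu, hcoe xstar hxsD] at this
    exact_mod_cast this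
  have hΦnorm : ∀ u ∈ D, Φ u ≤ Φ xstar → ‖xstar‖ ≤ ‖u‖ := fun u hu h => by
    refine hxstar_norm u fun v => le_trans ?_ (hxstar_min v)
    rw [hcoe u hu, hcoe xstar hxsD]
    exact_mod_cast h
  have hg_cont : Continuous g :=
    continuous_iff_continuousAt.2 fun u => (hg_diff u).hasFDerivAt.continuousAt
  have hclosed : ∀ c : ℝ, IsClosed {z ∈ D | Φ z ≤ c} := fun c => by
    have h1 : Continuous fun z : H => (z, ((c - g z : ℝ) : EReal)) :=
      continuous_id.prodMk (continuous_coe_real_ereal.comp (continuous_const.sub hg_cont))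
    have h2 := hf_lsc.isClosed_epigraph.preimage h1
    convert h2 using 1
    ext z
    simp only [Set.mem_ofPred_eq, Set.mem_preimage]
    constructor
    · rintro ⟨hz, h⟩
      rw [hcoe z hz, EReal.coe_le_coe_iff]
      exact le_sub_iff_add_le.2 h
    · intro h
      have hz : z ∈ D := ne_top_of_le_ne_top (EReal.coe_ne_top _) h
      rw [hcoe z hz, EReal.coe_le_coe_iff] at h
      exact ⟨hz, le_sub_iff_add_le.1 h⟩
  have hxD : ∀ k, 1 ≤ k → x (k + 1) ∈ D := fun k hk => by
    rw [hx k hk]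
    exact hmemD hz₀ (hprox s hs_pos _ z₀)
  have hfb : ∀ k, 1 ≤ k → s * (L + ε k) ≤ 1 → ∀ u ∈ D,
      Φ (x (k + 1)) + ε k / 2 * ‖x (k + 1)‖ ^ 2 + ‖u - x (k + 1)‖ ^ 2 / (2 * s)
        ≤ Φ u + ε k / 2 * ‖u‖ ^ 2 + ‖u - y k‖ ^ 2 / (2 * s) := fun k hk hsk u hu => by
    refine forward_backward_inequality hφ hg_convex hg_diff hg_lip hs_pos (hε_pos k hk).le hsk
      (hxD k hk) (fun v hv => ?_) hu
    have h := hprox s hs_pos (y k - s • g' (y k) - (s * ε k) • y k) v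
    rw [← hx k hk, hcoe v hv, hcoe _ (hxD k hk)] at h
    exact_mod_cast h
  have ht_one : ∀ k, 1 ≤ t k := fun k => by
    induction k with
    | zero => exact ht0.ge
    | succ k ih => exact ih.trans (hT (k + 1) (Nat.le_add_left 1 k)).1.le
  have ht_mono : ∀ k, t k < t (k + 1) := fun k => (hT (k + 1) (Nat.le_add_left 1 k)).1
  have ht_quad : ∀ k, t (k + 1) * (t (k + 1) - 1) ≤ t k ^ 2 := fun k => by
    have h := (hT (k + 1) (Nat.le_add_left 1 k)).2
    rw [Nat.add_sub_cancel] at h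
    have h1 : 2 * t (k + 1) - 1 ≤ √(1 + 4 * t k ^ 2) := by linarith
    have h2 := pow_le_pow_left₀ (by linarith [ht_one (k + 1)]) h1 2
    rw [Real.sq_sqrt (by positivity)] at h2
    nlinarith
  set W : ℕ → ℝ := fun k => t k ^ 2 * ε k with hWdef
  have hWmono : ∀ᶠ k in atTop, W k ≤ W (k + 1) := by
    filter_upwards [eventually_ge_atTop (k₀ - 1)] with k hk using (hincr k hk).le
  obtain ⟨c, hc, hcq⟩ : ∃ c > 0, ∀ᶠ k : ℕ in atTop,
      c ≤ (-(t k) ^ 2 + t k + (t (k - 1)) ^ 2) / t k := by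
    rw [liminf_eq] at hliminf
    obtain ⟨c, hcm, hc⟩ := exists_lt_of_lt_csSup (Set.nonempty_iff_ne_empty.2 fun h => by
      rw [h, Real.sSup_empty] at hliminf
      exact lt_irrefl _ hliminf) hliminf
    exact ⟨c, hc, hcm⟩
  have hsε : ∀ᶠ k in atTop, s * (L + ε k) ≤ 1 := by
    have h1 : Tendsto (fun k => s * (L + ε k)) atTop (𝓝 (s * (L + 0))) :=
      (hε_lim.const_add L).const_mul s
    have h2 : s * (L + 0) < 1 := by rw [add_zero]; exact (lt_div_iff₀ hL).1 hs_lt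
    exact (h1.eventually (gt_mem_nhds h2)).mono fun k hk => hk.le
  set z : ℕ → H := fun k => t (k - 1) • x k - (t (k - 1) - 1) • x (k - 1) with hzdef
  set θ : ℕ → ℝ := fun k => t k * (t k - 1) / t (k - 1) ^ 2 with hθdef
  have hty : ∀ k, t (k + 1) • y (k + 1)
      = (t (k + 1) - 1) • x (k + 1) + θ (k + 1) • z (k + 1) := fun k => by
    have h1 : t k ≠ 0 := (zero_lt_one.trans_le (ht_one k)).ne'
    have h2 : t (k + 1) ≠ 0 := (zero_lt_one.trans_le (ht_one (k + 1))).ne'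
    rw [hy (k + 1) (Nat.le_add_left 1 k)]
    simp only [hθdef, hzdef, Nat.add_sub_cancel]
    match_scalars <;> field_simp <;> ring
  have hθ01 : ∀ k, 0 ≤ θ (k + 1) ∧ θ (k + 1) ≤ 1 := fun k => by
    have h1 := ht_one k
    have h2 := ht_one (k + 1)
    simp only [hθdef, Nat.add_sub_cancel]
    exact ⟨div_nonneg (mul_nonneg (by linarith) (by linarith)) (sq_nonneg _),
      (div_le_one (by positivity)).2 (ht_quad k)⟩
  set E : ℕ → ℝ := fun k => t (k - 1) ^ 2 * (Φ (x k) + ε (k - 1) / 2 * ‖x k‖ ^ 2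
    - (Φ xstar + ε (k - 1) / 2 * ‖xstar‖ ^ 2)) + ‖z k - xstar‖ ^ 2 / (2 * s) with hEdef
  have hE : ∀ δ > 0, ∀ᶠ k in atTop, E (k + 1) ≤ δ * W k := by
    intro δ hδ
    refine eventually_le_of_averaged_recursion (a := fun k => 1 - θ k) hδ htε_top hWmono ?_ ?_
    · filter_upwards [eventually_ge_atTop 1] with k hk
      obtain ⟨j, rfl⟩ := Nat.exists_eq_add_of_le' hk
      constructor <;> linarith [hθ01 j]
    · have hr : ∀ᶠ k in atTop, t k * (ε k - ε (k + 1)) / ε k * ‖xstar‖ ^ 2 < c * δ := by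
        have h1 := hratio.mul_const (‖xstar‖ ^ 2)
        rw [zero_mul] at h1
        exact h1.eventually (gt_mem_nhds (mul_pos hc hδ))
      filter_upwards [eventually_ge_atTop 2, (tendsto_sub_atTop_nat 1).eventually hr,
        (tendsto_sub_atTop_nat 1).eventually hWmono, hcq, hsε,
        (htε_top.const_mul_atTop (half_pos hδ)).eventually_ge_atTop (‖xstar‖ ^ 2 / (2 * s))]
        with k hk hr hWk hq hsk hWl
      obtain ⟨j, rfl⟩ := Nat.exists_eq_add_of_le' (one_le_two.trans hk)
      have hj : 1 ≤ j := by omega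
      simp only [Nat.add_sub_cancel] at hr hWk hq
      have htj := ht_one j
      have htj' := ht_one (j + 1)
      have hεj := hε_pos j hj
      have hθj := hθ01 j
      have hxj : x (j + 1) ∈ D := hxD j hj
      have hstep := energy_step hΦ hs_pos (hε_pos (j + 1) (by omega)).le htj'
        (zero_lt_one.trans_le htj) (ht_quad j) hxj hxsD (hty j) (hfb (j + 1) (by omega) hsk)
      have hθτ : θ (j + 1) * t j ^ 2 = t (j + 1) * (t (j + 1) - 1) := by
        simp only [hθdef, Nat.add_sub_cancel]
        field_simp
      have hθeq : t (j + 1) * (t (j + 1) - 1) / t j ^ 2 = θ (j + 1) := by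
        simp only [hθdef, Nat.add_sub_cancel]
      rw [hθeq] at hstep
      have hE1 : E (j + 1 + 1) = t (j + 1) ^ 2 * (Φ (x (j + 1 + 1))
          + ε (j + 1) / 2 * ‖x (j + 1 + 1)‖ ^ 2 - (Φ xstar + ε (j + 1) / 2 * ‖xstar‖ ^ 2))
          + ‖t (j + 1) • x (j + 1 + 1) - (t (j + 1) - 1) • x (j + 1) - xstar‖ ^ 2 / (2 * s) := by
        simp only [hEdef, hzdef, Nat.add_sub_cancel]
      have hE0 : E (j + 1) = t j ^ 2 * (Φ (x (j + 1)) + ε j / 2 * ‖x (j + 1)‖ ^ 2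
          - (Φ xstar + ε j / 2 * ‖xstar‖ ^ 2)) + ‖z (j + 1) - xstar‖ ^ 2 / (2 * s) := by
        simp only [hEdef, Nat.add_sub_cancel]
      rw [← hE1] at hstep
      have hdε : 0 ≤ ε j - ε (j + 1) := sub_nonneg.2 (hε_anti j hj)
      have hchange : t j ^ 2 * (Φ (x (j + 1)) + ε (j + 1) / 2 * ‖x (j + 1)‖ ^ 2
          - (Φ xstar + ε (j + 1) / 2 * ‖xstar‖ ^ 2)) + ‖z (j + 1) - xstar‖ ^ 2 / (2 * s)
          ≤ E (j + 1) + t j ^ 2 * ((ε j - ε (j + 1)) / 2 * ‖xstar‖ ^ 2) := by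
        have : 0 ≤ t j ^ 2 * ((ε j - ε (j + 1)) / 2 * ‖x (j + 1)‖ ^ 2) := by positivity
        rw [hE0]
        linarith
      have hr' : t j * (ε j - ε (j + 1)) * ‖xstar‖ ^ 2 ≤ c * δ * ε j := by
        rw [div_mul_eq_mul_div, div_lt_iff₀ hεj] at hr
        exact hr.le
      have hq' : c * t (j + 1) ≤ (1 - θ (j + 1)) * t j ^ 2 := by
        rw [le_div_iff₀ (by linarith)] at hq
        linarith
      have haW : c * t j * ε j ≤ (1 - θ (j + 1)) * W (j + 1) :=
        calc c * t j * ε j ≤ c * t (j + 1) * ε j := by gcongr; exact (ht_mono j).le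
          _ ≤ (1 - θ (j + 1)) * t j ^ 2 * ε j := by gcongr
          _ = (1 - θ (j + 1)) * W j := by simp only [hWdef]; ring
          _ ≤ (1 - θ (j + 1)) * W (j + 1) :=
            mul_le_mul_of_nonneg_left hWk (sub_nonneg.2 hθj.2)
      have hforce : θ (j + 1) * (t j ^ 2 * ((ε j - ε (j + 1)) / 2 * ‖xstar‖ ^ 2))
          ≤ δ / 2 * ((1 - θ (j + 1)) * W (j + 1)) :=
        calc θ (j + 1) * (t j ^ 2 * ((ε j - ε (j + 1)) / 2 * ‖xstar‖ ^ 2))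
            ≤ t j ^ 2 * ((ε j - ε (j + 1)) / 2 * ‖xstar‖ ^ 2) :=
              mul_le_of_le_one_left (by positivity) hθj.2
          _ = t j / 2 * (t j * (ε j - ε (j + 1)) * ‖xstar‖ ^ 2) := by ring
          _ ≤ t j / 2 * (c * δ * ε j) := by gcongr
          _ = δ / 2 * (c * t j * ε j) := by ring
          _ ≤ δ / 2 * ((1 - θ (j + 1)) * W (j + 1)) := by gcongr
      have h1 := mul_le_mul_of_nonneg_left hchange hθj.1
      have h2 := mul_le_mul_of_nonneg_left hWl (sub_nonneg.2 hθj.2)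
      simp only [sub_sub_cancel]
      linarith
  have hgap : ∀ δ > 0, ∀ᶠ k in atTop, Φ (x (k + 1)) + ε k / 2 * ‖x (k + 1)‖ ^ 2
      - (Φ xstar + ε k / 2 * ‖xstar‖ ^ 2) ≤ δ * ε k := by
    intro δ hδ
    filter_upwards [hE δ hδ] with k hk
    have h1 : 0 < t k ^ 2 := pow_pos (zero_lt_one.trans_le (ht_one k)) 2
    have h2 : 0 ≤ ‖z (k + 1) - xstar‖ ^ 2 / (2 * s) := by positivity
    simp only [hEdef, hWdef, Nat.add_sub_cancel] at hk
    refine le_of_mul_le_mul_left ?_ h1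
    linarith
  have hx_lim : Tendsto x atTop (𝓝 xstar) := by
    refine (tendsto_add_atTop_iff_nat 1).1
      (tendsto_min_norm_minimizer hΦ hclosed hxsD hΦnorm ?_ ?_ ?_)
    · filter_upwards [eventually_ge_atTop 1] with k hk using hxD k hk
    · intro δ hδ
      have h1 : Tendsto (fun k => ε k * (1 + ‖xstar‖ ^ 2 / 2)) atTop (𝓝 0) := by
        simpa using hε_lim.mul_const (1 + ‖xstar‖ ^ 2 / 2)
      filter_upwards [hgap 1 one_pos, h1.eventually (gt_mem_nhds hδ), eventually_ge_atTop 1]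
        with k h2 h3 hk
      have := hε_pos k hk
      have : 0 ≤ ε k / 2 * ‖x (k + 1)‖ ^ 2 := by positivity
      linarith
    · intro δ hδ
      filter_upwards [hgap (δ / 2) (half_pos hδ), eventually_ge_atTop 1] with k h2 hk
      have h3 := hΦmin _ (hxD k hk)
      have h4 := hε_pos k hk
      refine le_of_mul_le_mul_left ?_ (half_pos h4)
      linarith
  have hz_small : ∀ δ > 0, ∀ᶠ k in atTop, ‖z k - xstar‖ ^ 2 ≤ δ * W k := by
    intro δ hδ
    have hδ' : 0 < δ / (4 * s) := by positivity
    have hxn : ∀ᶠ k in atTop, ‖xstar‖ ^ 2 - 2 * (δ / (4 * s)) < ‖x (k + 1)‖ ^ 2 :=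
      (((hx_lim.comp (tendsto_add_atTop_nat 1)).norm.pow 2).eventually
        (lt_mem_nhds (by linarith)))
    have h : ∀ᶠ k in atTop, ‖z (k + 1) - xstar‖ ^ 2 ≤ δ * W (k + 1) := by
      filter_upwards [hE _ hδ', hxn, hWmono, eventually_ge_atTop 1] with k h1 h2 h3 hk
      have h4 := hΦmin _ (hxD k hk)
      have h5 := hε_pos k hk
      have h6 : 0 < t k ^ 2 := pow_pos (zero_lt_one.trans_le (ht_one k)) 2
      simp only [hEdef, Nat.add_sub_cancel] at h1
      have h7 : -(δ / (4 * s)) * ε k ≤ Φ (x (k + 1)) + ε k / 2 * ‖x (k + 1)‖ ^ 2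
          - (Φ xstar + ε k / 2 * ‖xstar‖ ^ 2) := by
        have := mul_le_mul_of_nonneg_left h2.le (half_pos h5).le
        linarith
      have h8 := mul_le_mul_of_nonneg_left h7 h6.le
      have h9 : ‖z (k + 1) - xstar‖ ^ 2 / (2 * s) ≤ 2 * (δ / (4 * s)) * W k := by
        simp only [hWdef] at h1 ⊢
        linarith
      rw [div_le_iff₀ (by positivity)] at h9
      calc ‖z (k + 1) - xstar‖ ^ 2 ≤ 2 * (δ / (4 * s)) * W k * (2 * s) := h9
        _ = δ * W k := by field_simp; norm_num
        _ ≤ δ * W (k + 1) := mul_le_mul_of_nonneg_left h3 hδ.le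
    filter_upwards [(tendsto_sub_atTop_nat 1).eventually h, eventually_ge_atTop 1] with k hk h1
    rwa [Nat.sub_add_cancel h1] at hk
  have hratio_lim : Tendsto (fun k => ‖x k - y k‖ / √(ε k)) atTop (𝓝 0) := by
    rw [Metric.tendsto_nhds]
    intro η hη
    have hWsqrt : Tendsto (fun k => η / 4 * √(W k)) atTop atTop :=
      (Real.tendsto_sqrt_atTop.comp htε_top).const_mul_atTop (by positivity)
    filter_upwards [hz_small ((η / 2) ^ 2) (by positivity), eventually_ge_atTop 1,
      hWsqrt.eventually_ge_atTop (‖xstar‖ + (‖xstar‖ + 1)),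
      hx_lim.norm.eventually (gt_mem_nhds (lt_add_one ‖xstar‖))] with k h1 hk h2 h3
    obtain ⟨j, rfl⟩ := Nat.exists_eq_add_of_le' hk
    have htj : 0 < t (j + 1) := zero_lt_one.trans_le (ht_one _)
    have hεj := Real.sqrt_pos.2 (hε_pos (j + 1) hk)
    have hθj := hθ01 j
    have hWs : √(W (j + 1)) = t (j + 1) * √(ε (j + 1)) := by
      simp only [hWdef]
      rw [Real.sqrt_mul (sq_nonneg _), Real.sqrt_sq htj.le]
    have hW0 : 0 ≤ W (j + 1) := mul_nonneg (sq_nonneg _) (hε_pos (j + 1) hk).le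
    have hz1 : ‖z (j + 1) - xstar‖ ≤ η / 2 * √(W (j + 1)) := by
      refine abs_le_of_sq_le_sq' ?_ (by positivity) |>.2
      rwa [mul_pow, Real.sq_sqrt hW0]
    have hxy : t (j + 1) • (x (j + 1) - y (j + 1))
        = x (j + 1) - θ (j + 1) • (z (j + 1) - xstar) - θ (j + 1) • xstar := by
      rw [smul_sub, hty j]
      module
    have hn : t (j + 1) * ‖x (j + 1) - y (j + 1)‖
        ≤ ‖x (j + 1)‖ + ‖z (j + 1) - xstar‖ + ‖xstar‖ := by
      have hsm : ∀ v : H, ‖θ (j + 1) • v‖ ≤ ‖v‖ := fun v => by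
        rw [norm_smul, Real.norm_of_nonneg hθj.1]
        exact mul_le_of_le_one_left (norm_nonneg v) hθj.2
      rw [← Real.norm_of_nonneg htj.le, ← norm_smul, hxy]
      refine (norm_sub_le _ _).trans (add_le_add ((norm_sub_le _ _).trans ?_) (hsm _))
      exact add_le_add le_rfl (hsm _)
    have hfin : t (j + 1) * ‖x (j + 1) - y (j + 1)‖ < t (j + 1) * (η * √(ε (j + 1))) := by
      have : 0 < η * (t (j + 1) * √(ε (j + 1))) := by positivity
      rw [hWs] at hz1 h2
      linarith
    rw [dist_zero_right, norm_div, norm_norm, Real.norm_of_nonneg hεj.le, div_lt_iff₀ hεj]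
    exact lt_of_mul_lt_mul_left hfin htj.le
  refine ⟨hx_lim, hratio_lim, ?_⟩
  have hdiff : Tendsto (fun k => x k - y k) atTop (𝓝 0) := by
    rw [tendsto_zero_iff_norm_tendsto_zero]
    have h1 : Tendsto (fun k => ‖x k - y k‖ / √(ε k) * √(ε k)) atTop (𝓝 0) := by
      simpa using hratio_lim.mul hε_lim.sqrt
    refine h1.congr' ?_
    filter_upwards [eventually_ge_atTop 1] with k hk
    exact div_mul_cancel₀ _ (Real.sqrt_pos.2 (hε_pos k hk)).ne'
  simpa using hx_lim.sub hdiff
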